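/- The Petersen graph has no external bisection: there is no partition of its 10 vertices into two sets of size 5 such that every vertex has at least 2 of its 3 neighbors in the opposite part. -/

import Mathlib

open Finset

open scoped Classical in
noncomputable def degIn {V : Type*} (G : SimpleGraph V) (S : Finset V) (x : V) : ℕ :=
  (S.filter fun y => G.Adj x y).card

/-- The Petersen graph, as the Kneser graph K(5,2): vertices are the 2-element subsets of
a 5-element set, adjacent iff disjoint. -/
noncomputable def petersen : SimpleGraph {s : Finset (Fin 5) // s.card = 2} :=
  SimpleGraph.fromRel fun a b => Disjoint a.1 b.1

/-- Enumeration of the ten vertices. -/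
def vtx : Fin 10 → {s : Finset (Fin 5) // s.card = 2} :=
  ![⟨{0, 1}, by decide⟩, ⟨{0, 2}, by decide⟩, ⟨{0, 3}, by decide⟩, ⟨{0, 4}, by decide⟩, ⟨{1, 2}, by decide⟩, ⟨{1, 3}, by decide⟩, ⟨{1, 4}, by decide⟩, ⟨{2, 3}, by decide⟩, ⟨{2, 4}, by decide⟩, ⟨{3, 4}, by decide⟩]

/-- The three neighbours of each vertex, by index. -/
def nbr : Fin 10 → Finset (Fin 10) :=
  ![{7, 8, 9}, {5, 6, 9}, {4, 6, 8}, {4, 5, 7}, {2, 3, 9}, {1, 3, 8}, {1, 2, 7}, {0, 3, 6}, {0, 2, 5}, {0, 1, 4}]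

theorem vtx_bijective : Function.Bijective vtx := by
  constructor
  · decide
  · decide

theorem adj_iff : ∀ i j : Fin 10, ((vtx i ≠ vtx j) ∧
    (Disjoint (vtx i).1 (vtx j).1 ∨ Disjoint (vtx j).1 (vtx i).1)) ↔ j ∈ nbr i := by
  decide

theorem degIn_eq (S : Finset {s : Finset (Fin 5) // s.card = 2}) (i : Fin 10) :
    degIn petersen S (vtx i) = ∑ j ∈ nbr i, if vtx j ∈ S then 1 else 0 := by
  classical
  have h : S.filter (fun y => petersen.Adj (vtx i) y)
      = ((nbr i).filter (fun j => vtx j ∈ S)).map ⟨vtx, vtx_bijective.1⟩ := by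
    ext y
    obtain ⟨j, rfl⟩ := vtx_bijective.2 y
    have := adj_iff i j
    simp only [mem_filter, mem_map, Function.Embedding.coeFn_mk, petersen,
      SimpleGraph.fromRel_adj, this]
    constructor
    · rintro ⟨h1, h2⟩
      exact ⟨j, ⟨h2, h1⟩, rfl⟩
    · rintro ⟨k, ⟨h2, h1⟩, hk⟩
      obtain rfl := vtx_bijective.1 hk
      exact ⟨h1, h2⟩
  unfold degIn
  rw [← card_filter, ← card_map ⟨vtx, vtx_bijective.1⟩, ← h]

theorem sum_ten (f : Fin 10 → ℕ) :
    ∑ j, f j = f 0 + f 1 + f 2 + f 3 + f 4 + f 5 + f 6 + f 7 + f 8 + f 9 := by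
  simp only [Fin.sum_univ_castSucc, Fin.sum_univ_zero, zero_add]
  rfl

theorem card_eq (S : Finset {s : Finset (Fin 5) // s.card = 2}) :
    S.card = ∑ j, if vtx j ∈ S then 1 else 0 := by
  rw [vtx_bijective.sum_comp (fun y => if y ∈ S then 1 else 0)]
  simp

/-- At least two of three Booleans are true. -/
def twoOfThree (a b c : Bool) : Bool := (a && b) || (a && c) || (b && c)

theorem bool_core : ∀ b0 b1 b2 b3 b4 b5 b6 b7 b8 b9 : Bool,
    (twoOfThree (b0 ^^ b7) (b0 ^^ b8) (b0 ^^ b9) = true) →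
    (twoOfThree (b1 ^^ b5) (b1 ^^ b6) (b1 ^^ b9) = true) →
    (twoOfThree (b2 ^^ b4) (b2 ^^ b6) (b2 ^^ b8) = true) →
    (twoOfThree (b3 ^^ b4) (b3 ^^ b5) (b3 ^^ b7) = true) →
    (twoOfThree (b4 ^^ b2) (b4 ^^ b3) (b4 ^^ b9) = true) →
    (twoOfThree (b5 ^^ b1) (b5 ^^ b3) (b5 ^^ b8) = true) →
    (twoOfThree (b6 ^^ b1) (b6 ^^ b2) (b6 ^^ b7) = true) →
    (twoOfThree (b7 ^^ b0) (b7 ^^ b3) (b7 ^^ b6) = true) →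
    (twoOfThree (b8 ^^ b0) (b8 ^^ b2) (b8 ^^ b5) = true) →
    (twoOfThree (b9 ^^ b0) (b9 ^^ b1) (b9 ^^ b4) = true) →
    b0.toNat + b1.toNat + b2.toNat + b3.toNat + b4.toNat + b5.toNat + b6.toNat + b7.toNat
      + b8.toNat + b9.toNat ≠ 5 := by
  decide

theorem twoOfThree_of (A : Finset {s : Finset (Fin 5) // s.card = 2})
    (hA : ∀ x ∈ A, 2 ≤ degIn petersen Aᶜ x) (hB : ∀ y ∈ Aᶜ, 2 ≤ degIn petersen A y)
    (i x y z : Fin 10) (hn : nbr i = {x, y, z}) (hxy : x ≠ y) (hxz : x ≠ z) (hyz : y ≠ z) :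
    twoOfThree (decide (vtx i ∈ A) ^^ decide (vtx x ∈ A))
      (decide (vtx i ∈ A) ^^ decide (vtx y ∈ A))
      (decide (vtx i ∈ A) ^^ decide (vtx z ∈ A)) = true := by
  have hA := hA (vtx i)
  have hB := hB (vtx i)
  rw [degIn_eq, hn, sum_insert (by simp [hxy, hxz]), sum_insert (by simp [hyz]),
    sum_singleton] at hA hB
  simp only [mem_compl] at hA hB
  by_cases h0 : vtx i ∈ A <;> by_cases h1 : vtx x ∈ A <;> by_cases h2 : vtx y ∈ A <;>
    by_cases h3 : vtx z ∈ A <;> simp_all [twoOfThree]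

/-- The Petersen graph has no external bisection. -/
theorem petersen_no_external_bisection :
    ¬ ∃ A : Finset {s : Finset (Fin 5) // s.card = 2}, A.card = 5 ∧ Aᶜ.card = 5 ∧
      (∀ x ∈ A, 2 ≤ degIn petersen Aᶜ x) ∧ (∀ y ∈ Aᶜ, 2 ≤ degIn petersen A y) := by
  rintro ⟨A, hc, -, hA, hB⟩
  have key := twoOfThree_of A hA hB
  refine bool_core _ _ _ _ _ _ _ _ _ _
    (key 0 7 8 9 (by decide) (by decide) (by decide) (by decide))
    (key 1 5 6 9 (by decide) (by decide) (by decide) (by decide))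
    (key 2 4 6 8 (by decide) (by decide) (by decide) (by decide))
    (key 3 4 5 7 (by decide) (by decide) (by decide) (by decide))
    (key 4 2 3 9 (by decide) (by decide) (by decide) (by decide))
    (key 5 1 3 8 (by decide) (by decide) (by decide) (by decide))
    (key 6 1 2 7 (by decide) (by decide) (by decide) (by decide))
    (key 7 0 3 6 (by decide) (by decide) (by decide) (by decide))
    (key 8 0 2 5 (by decide) (by decide) (by decide) (by decide))
    (key 9 0 1 4 (by decide) (by decide) (by decide) (by decide))
    ?_
  rw [card_eq] at hc
  refine Eq.trans ?_ hc
  have hd : ∀ j, (decide (vtx j ∈ A)).toNat = if vtx j ∈ A then 1 else 0 := by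
    intro j
    by_cases h : vtx j ∈ A <;> simp [h]
  simp only [hd]
  exact (sum_ten (fun j => if vtx j ∈ A then 1 else 0)).symm
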